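/- Let k be a finite field of characteristic p ≠ 2, let R be an algebraically closed field of characteristic different from p, let n ≥ 2, and let r ≥ s ≥ 0 be integers with r + s = n. Let G = GL_n(k), let P be the mirabolic subgroup of G (matrices whose last row is (0, …, 0, 1)), let N be the subgroup of upper unitriangular matrices, let ψ be a nontrivial R-valued character of the additive group of k, let ψ_N be the character of N given by x ↦ ψ(x_{1,2} + ⋯ + x_{n−1,n}), and let Γ = Ind_N^P(ψ_N) be the mirabolic representation of P. Set t = r − s + 1, let w_{r,s} ∈ G be the permutation matrix of the permutation of {1, …, n} fixing 1, …, t and n, sending t + i to t + 2i for 1 ≤ i ≤ s − 1, and sending r + j to t + 2j − 1 for 1 ≤ j ≤ s − 1, and let H_{r,s} = w_{r,s} · (GL_r(k) × GL_s(k)) · w_{r,s}^{−1}, the conjugate by w_{r,s} of the block-diagonal Levi subgroup GL_r(k) × GL_s(k). Let χ be a character of H_{r,s}. If Hom_{P ∩ H_{r,s}}(Γ, χ) ≠ 0, then r = s. -/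

import Mathlib

open Matrix

section RightRegular

variable {R : Type} [CommRing R] {G : Type} [Group G] {V : Type} [AddCommGroup V] [Module R V]

/-- The right-translation representation of `G` on a translation-invariant submodule of
the space of `V`-valued functions on `G`. -/
def rightRegular (C : Submodule R (G → V))
    (hC : ∀ g : G, ∀ f ∈ C, (fun x => f (x * g)) ∈ C) :
    Representation R G ↥C where
  toFun g := LinearMap.restrict
    { toFun := fun (f : G → V) => (fun x => f (x * g))
      map_add' := fun _ _ => rfl
      map_smul' := fun _ _ => by rfl } (fun f hf => hC g f hf)
  map_one' := by
    apply LinearMap.ext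
    intro f
    apply Subtype.ext
    funext x
    simp [LinearMap.restrict_apply]
  map_mul' := by
    intro g g'
    apply LinearMap.ext
    intro f
    apply Subtype.ext
    funext x
    simp [LinearMap.restrict_apply, mul_assoc]

/-- The space of the representation of `G` induced from a representation `τ` of a
subgroup `P`. -/
def indCarrier {W : Type} [AddCommGroup W] [Module R W]
    (P : Subgroup G) (τ : Representation R ↥P W) : Submodule R (G → W) where
  carrier := {f | ∀ (p : ↥P) (g : G), f (↑p * g) = τ p (f g)}
  add_mem' := by
    intro f₁ f₂ h₁ h₂ p g
    simp [h₁ p g, h₂ p g]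
  zero_mem' := by intro p g; simp
  smul_mem' := by
    intro c f hf p g
    simp [hf p g]

/-- The representation of `G` induced from a representation `τ` of a subgroup `P`,
realized on functions `f : G → W` with `f (p * g) = τ p (f g)`, with `G` acting by right
translation. -/
def inducedRep {W : Type} [AddCommGroup W] [Module R W]
    (P : Subgroup G) (τ : Representation R ↥P W) :
    Representation R G ↥(indCarrier P τ) :=
  rightRegular (indCarrier P τ) (by
    intro g f hf p x
    simpa [mul_assoc] using hf p (x * g))

end RightRegular
section Mirabolic

variable (k : Type) [Field k]

/-- The mirabolic subgroup of `GL n k`:  matrices whose last row is `(0, …, 0, 1)`. -/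
def mirabolic (n : ℕ) (hn : 0 < n) : Subgroup (GL (Fin n) k) where
  carrier := {g | ∀ j : Fin n,
    (g : Matrix (Fin n) (Fin n) k) ⟨n - 1, by omega⟩ j = if (j : ℕ) = n - 1 then 1 else 0}
  one_mem' := by
    intro j
    have hcond : (⟨n - 1, by omega⟩ : Fin n) = j ↔ (j : ℕ) = n - 1 := by
      rw [Fin.ext_iff]; exact eq_comm
    show ((1 : GL (Fin n) k) : Matrix (Fin n) (Fin n) k) ⟨n - 1, by omega⟩ j = _
    rw [Units.val_one, Matrix.one_apply]
    simp only [hcond]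
  mul_mem' := by
    intro a b ha hb
    intro j
    show ((a * b : GL (Fin n) k) : Matrix (Fin n) (Fin n) k) ⟨n - 1, by omega⟩ j = _
    have hcoe : ((a * b : GL (Fin n) k) : Matrix (Fin n) (Fin n) k)
        = (a : Matrix (Fin n) (Fin n) k) * (b : Matrix (Fin n) (Fin n) k) := rfl
    rw [hcoe, Matrix.mul_apply]
    have hsum : ∀ l : Fin n, (a : Matrix (Fin n) (Fin n) k) ⟨n - 1, by omega⟩ l
          * (b : Matrix (Fin n) (Fin n) k) l j
        = if l = (⟨n - 1, by omega⟩ : Fin n) then (b : Matrix (Fin n) (Fin n) k) l j else 0 := by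
      intro l
      rw [ha l]
      rcases eq_or_ne (l : ℕ) (n - 1) with h | h
      · have hl : l = (⟨n - 1, by omega⟩ : Fin n) := by
          apply Fin.ext; exact h
        simp [h, hl]
      · have hl : l ≠ (⟨n - 1, by omega⟩ : Fin n) := by
          intro e; exact h (by rw [e])
        simp [h, hl]
    rw [Finset.sum_congr rfl (fun l _ => hsum l)]
    rw [Finset.sum_ite_eq' Finset.univ (⟨n - 1, by omega⟩ : Fin n)
      (fun l => (b : Matrix (Fin n) (Fin n) k) l j)]
    simpa using hb j
  inv_mem' := by
    intro a ha j
    have hcoe : (a : Matrix (Fin n) (Fin n) k)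
        * ((a⁻¹ : GL (Fin n) k) : Matrix (Fin n) (Fin n) k) = 1 := by
      rw [← Units.val_mul, mul_inv_cancel, Units.val_one]
    have happ := congrArg (fun M : Matrix (Fin n) (Fin n) k =>
      M (⟨n - 1, by omega⟩ : Fin n) j) hcoe
    simp only [Matrix.mul_apply] at happ
    have hsum : ∀ l : Fin n, (a : Matrix (Fin n) (Fin n) k) ⟨n - 1, by omega⟩ l
          * ((a⁻¹ : GL (Fin n) k) : Matrix (Fin n) (Fin n) k) l j
        = if l = (⟨n - 1, by omega⟩ : Fin n)
            then ((a⁻¹ : GL (Fin n) k) : Matrix (Fin n) (Fin n) k) l j else 0 := by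
      intro l
      rw [ha l]
      rcases eq_or_ne (l : ℕ) (n - 1) with h | h
      · have hl : l = (⟨n - 1, by omega⟩ : Fin n) := by
          apply Fin.ext; exact h
        simp [h, hl]
      · have hl : l ≠ (⟨n - 1, by omega⟩ : Fin n) := by
          intro e; exact h (by rw [e])
        simp [h, hl]
    rw [Finset.sum_congr rfl (fun l _ => hsum l),
      Finset.sum_ite_eq' Finset.univ (⟨n - 1, by omega⟩ : Fin n)
        (fun l => ((a⁻¹ : GL (Fin n) k) : Matrix (Fin n) (Fin n) k) l j)] at happ
    have hone : (1 : Matrix (Fin n) (Fin n) k) (⟨n - 1, by omega⟩ : Fin n) j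
        = if (j : ℕ) = n - 1 then 1 else 0 := by
      rw [Matrix.one_apply]
      have hcond : (⟨n - 1, by omega⟩ : Fin n) = j ↔ (j : ℕ) = n - 1 := by
        rw [Fin.ext_iff]; exact eq_comm
      simp only [hcond]
    show ((a⁻¹ : GL (Fin n) k) : Matrix (Fin n) (Fin n) k) ⟨n - 1, by omega⟩ j = _
    rw [← hone, ← happ]
    simp

/-- The sum of the superdiagonal entries of a matrix. -/
def superDiagSum {n : ℕ} (M : Matrix (Fin n) (Fin n) k) : k :=
  ∑ i : Fin (n - 1), M ⟨i.val, by have := i.isLt; omega⟩ ⟨i.val + 1, by have := i.isLt; omega⟩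

end Mirabolic
section Levi

variable (k : Type) [Field k]

lemma levi_mem_iff {n r : ℕ} (B : Fin n → Fin r) (M : Matrix (Fin n) (Fin n) k) :
    (∀ i j, B i ≠ B j → M i j = 0) ↔
      (Matrix.BlockTriangular M B ∧ Matrix.BlockTriangular M (OrderDual.toDual ∘ B)) := by
  constructor
  · intro h
    refine ⟨fun i j hij => h i j (ne_of_gt hij), fun i j hij => h i j (ne_of_lt ?_)⟩
    exact OrderDual.toDual_lt_toDual.mp hij
  · rintro ⟨h₁, h₂⟩ i j hij
    rcases lt_or_gt_of_ne hij with hlt | hgt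
    · exact h₂ (by simpa using hlt)
    · exact h₁ hgt

/-- The block-diagonal Levi subgroup of `GL n k` attached to a block function `B`. -/
def levi (n r : ℕ) (B : Fin n → Fin r) : Subgroup (GL (Fin n) k) where
  carrier := {g | ∀ i j, B i ≠ B j → (g : Matrix (Fin n) (Fin n) k) i j = 0}
  one_mem' := by
    intro i j hij
    have hne : i ≠ j := fun h => hij (by rw [h])
    simp [Matrix.one_apply, hne]
  mul_mem' := by
    intro a b ha hb
    have h : ((a * b : GL (Fin n) k) : Matrix (Fin n) (Fin n) k)
        = (a : Matrix (Fin n) (Fin n) k) * (b : Matrix (Fin n) (Fin n) k) := rfl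
    rw [Set.mem_setOf_eq] at ha hb ⊢
    rw [levi_mem_iff] at ha hb ⊢
    rw [h]
    exact ⟨ha.1.mul hb.1, ha.2.mul hb.2⟩
  inv_mem' := by
    intro a ha
    have h : ((a⁻¹ : GL (Fin n) k) : Matrix (Fin n) (Fin n) k)
        = (a : Matrix (Fin n) (Fin n) k)⁻¹ := by
      simp [Matrix.coe_units_inv]
    rw [Set.mem_setOf_eq] at ha ⊢
    rw [levi_mem_iff] at ha ⊢
    rw [h]
    haveI : Invertible (a : Matrix (Fin n) (Fin n) k) := a.invertible
    exact ⟨Matrix.blockTriangular_inv_of_blockTriangular ha.1,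
      Matrix.blockTriangular_inv_of_blockTriangular ha.2⟩

end Levi
/-- The block function on `Fin n` describing two consecutive blocks, the first of size `r`. -/
def twoBlocks (n r : ℕ) : Fin n → Fin 2 := fun i => if (i : ℕ) < r then 0 else 1

section Gamma

variable {k : Type} [Field k] {R : Type} [Field R]

/-- The space of the mirabolic representation `Γ = Ind_N^P ψ_N`:  functions on the mirabolic
subgroup transforming on the left under the upper unitriangular subgroup `N` by the
nondegenerate character attached to `ψ`. -/
def gammaCarrier (n : ℕ) (hn : 0 < n) (ψ : AddChar k R) :
    Submodule R (↥(mirabolic k n hn) → R) where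
  carrier := {f | ∀ u x : ↥(mirabolic k n hn),
    (∀ i j : Fin n, j ≤ i →
      ((u : GL (Fin n) k) : Matrix (Fin n) (Fin n) k) i j = if i = j then 1 else 0) →
    f (u * x) = ψ (superDiagSum k (((u : GL (Fin n) k) : Matrix (Fin n) (Fin n) k))) * f x}
  zero_mem' := by intro u x hu; simp
  add_mem' := by
    intro f g hf hg u x hu
    simp only [Pi.add_apply, hf u x hu, hg u x hu, mul_add]
  smul_mem' := by
    intro c f hf u x hu
    simp only [Pi.smul_apply, smul_eq_mul, hf u x hu]
    ring

/-- The mirabolic representation `Γ` of the mirabolic subgroup, by right translation. -/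
def gammaRep (n : ℕ) (hn : 0 < n) (ψ : AddChar k R) :
    Representation R ↥(mirabolic k n hn) ↥(gammaCarrier n hn ψ) :=
  rightRegular (gammaCarrier n hn ψ) (by
    intro g f hf u x hu
    simpa [mul_assoc] using hf u (x * g) hu)

end Gamma

/-- The permutation of positions (`0`-indexed) underlying the permutation matrix `w_{r,s}`:
in `1`-indexed terms, with `t = r - s + 1`, it fixes `1, …, t` and `n`, sends `t + i` to
`t + 2i` for `1 ≤ i ≤ s - 1`, and sends `r + j` to `t + 2j - 1` for `1 ≤ j ≤ s - 1`. -/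
def wfun (n r s i : ℕ) : ℕ :=
  let t := r - s + 1
  let a := i + 1
  if a ≤ t then i
  else if a ≤ r then t + 2 * (a - t) - 1
  else if a ≤ n - 1 then t + 2 * (a - r) - 2
  else i

section Unitriangular

variable {k : Type} [Field k] {n : ℕ}

lemma mul_apply_of_unitriangular {a b : Matrix (Fin n) (Fin n) k}
    (ha : ∀ i j : Fin n, j ≤ i → a i j = if i = j then 1 else 0)
    (hb : ∀ i j : Fin n, j < i → b i j = 0) {i j : Fin n} (hij : j ≤ i) :
    (a * b) i j = b i j := by
  rw [Matrix.mul_apply, Finset.sum_eq_single i]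
  · simp [ha i i le_rfl]
  · intro l _ hl
    rcases lt_or_gt_of_ne hl with h | h
    · rw [ha i l h.le, if_neg hl.symm, zero_mul]
    · rw [hb l j (hij.trans_lt h), mul_zero]
  · simp

variable (k n) in
/-- The subgroup of upper unitriangular matrices of `GL n k`. -/
def unitriangular : Subgroup (GL (Fin n) k) where
  carrier := {g | ∀ i j : Fin n, j ≤ i →
    (g : Matrix (Fin n) (Fin n) k) i j = if i = j then 1 else 0}
  one_mem' := fun i j _ => by rw [Units.val_one, Matrix.one_apply]
  mul_mem' := fun {a b} ha hb i j hij => by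
    rw [Units.val_mul, mul_apply_of_unitriangular ha _ hij, hb i j hij]
    intro i j hij
    rw [hb i j hij.le, if_neg hij.ne']
  inv_mem' := fun {a} ha i j hij => by
    have : Invertible (a : Matrix (Fin n) (Fin n) k) := a.invertible
    have hinv : Matrix.BlockTriangular ((a⁻¹ : GL (Fin n) k) : Matrix (Fin n) (Fin n) k) id := by
      rw [Matrix.coe_units_inv]
      refine Matrix.blockTriangular_inv_of_blockTriangular fun i j hij => ?_
      exact (ha i j (le_of_lt hij)).trans (if_neg (ne_of_gt hij))
    rw [← mul_apply_of_unitriangular ha (fun i j hij => hinv hij) hij, ← Units.val_mul,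
      mul_inv_cancel, Units.val_one, Matrix.one_apply]

lemma unitriangular_le_mirabolic (hn : 0 < n) : unitriangular k n ≤ mirabolic k n hn := by
  intro g hg j
  rw [hg _ _ (Fin.le_def.2 (by have := j.isLt; simp only; omega))]
  simp only [Fin.ext_iff, eq_comm]

end Unitriangular

section Coset

variable {k : Type} [Field k] {R : Type} [Field R] {n : ℕ}

/-- A nonzero linear form on `Γ` does not vanish on some function supported on a single
coset of the unitriangular subgroup. -/
lemma exists_coset_supported [Finite k] (hn : 0 < n) (ψ : AddChar k R)
    (Λ : ↥(gammaCarrier n hn ψ) →ₗ[R] R) (hΛ : Λ ≠ 0) :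
    ∃ (g : ↥(mirabolic k n hn)) (F : ↥(gammaCarrier n hn ψ)), Λ F ≠ 0 ∧
      ∀ x : ↥(mirabolic k n hn),
        ((x * g⁻¹ : ↥(mirabolic k n hn)) : GL (Fin n) k) ∉ unitriangular k n → F.1 x = 0 := by
  classical
  obtain ⟨f, hf⟩ : ∃ f, Λ f ≠ 0 := by
    by_contra! h
    exact hΛ (LinearMap.ext h)
  let N := (unitriangular k n).subgroupOf (mirabolic k n hn)
  have : Finite (Matrix (Fin n) (Fin n) k) := inferInstanceAs (Finite (Fin n → Fin n → k))
  have : Finite (GL (Fin n) k) := inferInstance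
  let : Fintype (Quotient (QuotientGroup.rightRel N)) := Fintype.ofFinite _
  let F (c : Quotient (QuotientGroup.rightRel N)) : ↥(gammaCarrier n hn ψ) :=
    ⟨fun x => if Quotient.mk _ x = c then f.1 x else 0, by
      intro u x hu
      have hux : (Quotient.mk (QuotientGroup.rightRel N) (u * x)) = Quotient.mk _ x := by
        refine Quotient.sound' (QuotientGroup.rightRel_apply.2 ?_)
        have hu' : u ∈ N := hu
        simpa using N.inv_mem hu'
      simp only [hux, f.2 u x hu, mul_ite, mul_zero]⟩
  have hsum : f = ∑ c, F c := by
    refine Subtype.ext (funext fun x => ?_)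
    rw [AddSubmonoidClass.coe_finsetSum, Finset.sum_apply]
    simp [F]
  obtain ⟨c, hc⟩ : ∃ c, Λ (F c) ≠ 0 := by
    by_contra! h
    exact hf (by rw [hsum, map_sum, Finset.sum_eq_zero fun c _ => h c])
  obtain ⟨g, rfl⟩ := Quotient.exists_rep c
  refine ⟨g, _, hc, fun x hx => if_neg fun h => hx ?_⟩
  have := QuotientGroup.rightRel_apply.1 (Quotient.exact h.symm)
  exact this

lemma gammaRep_of_coset_supported (hn : 0 < n) (ψ : AddChar k R) (g : ↥(mirabolic k n hn))
    (F : ↥(gammaCarrier n hn ψ))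
    (hF : ∀ x : ↥(mirabolic k n hn),
      ((x * g⁻¹ : ↥(mirabolic k n hn)) : GL (Fin n) k) ∉ unitriangular k n → F.1 x = 0)
    (u h : ↥(mirabolic k n hn)) (hu : (u : GL (Fin n) k) ∈ unitriangular k n)
    (hgh : g * h = u * g) :
    gammaRep n hn ψ h F
      = ψ (superDiagSum k ((u : GL (Fin n) k) : Matrix (Fin n) (Fin n) k)) • F := by
  refine Subtype.ext (funext fun x => ?_)
  change F.1 (x * h) = ψ _ * F.1 x
  have hxh : x * h * g⁻¹ = x * g⁻¹ * u := by
    rw [mul_assoc x g⁻¹ u, mul_assoc x h, eq_inv_mul_of_mul_eq hgh]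
    group
  by_cases hx : ((x * g⁻¹ : ↥(mirabolic k n hn)) : GL (Fin n) k) ∈ unitriangular k n
  · have h1 : x * h = (x * g⁻¹) * (u * g) := by rw [← hgh]; group
    have h2 : F.1 x = F.1 ((x * g⁻¹) * g) := by group
    rw [h1, h2, F.2 _ _ hx, F.2 _ _ hx, F.2 _ _ hu]
    ring
  · rw [hF x hx, hF (x * h), mul_zero]
    rw [hxh]
    intro h'
    exact hx (by simpa using mul_mem h' (inv_mem hu))

end Coset

section Idempotent

variable {k : Type} [Field k] {R : Type} [Field R] {n : ℕ}

lemma idempotent_single_mul {Q : Matrix (Fin n) (Fin n) k} (hQ : Q * Q = Q) (a b c d : Fin n) :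
    (Q * single a b 1 * Q) * (Q * single c d 1 * Q) = Q b c • (Q * single a d 1 * Q) := by
  have h : (Q * single a b 1 * Q) * (Q * single c d 1 * Q)
      = Q * (single a b 1 * (Q * Q) * single c d 1) * Q := by
    simp only [Matrix.mul_assoc]
  have h2 : single a b (1 : k) * Q * single c d 1 = Q b c • single a d 1 := by
    rw [single_mul_mul_single]; simp [smul_single]
  rw [h, hQ, h2, Matrix.mul_smul, Matrix.smul_mul]

lemma mul_single_mul_apply (Q : Matrix (Fin n) (Fin n) k) (a b i j : Fin n) :
    (Q * (single a b 1 : Matrix (Fin n) (Fin n) k) * Q) i j = Q i a * Q b j := by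
  rw [Matrix.mul_apply, Finset.sum_eq_single b]
  · simp
  · intro l _ hl
    rw [mul_single_apply_of_ne _ _ _ _ _ hl, zero_mul]
  · simp

/-- The condition on the centralizer of `Q` extracted from the existence of an equivariant
linear form. -/
def TrivialOnCentralizer (ψ : AddChar k R) (Q : Matrix (Fin n) (Fin n) k) : Prop :=
  ∀ u t : GL (Fin n) k, u ∈ unitriangular k n → Commute (u : Matrix (Fin n) (Fin n) k) Q →
    Commute (t : Matrix (Fin n) (Fin n) k) Q → t * u = u⁻¹ * t →
    ψ (superDiagSum k ((u * u : GL (Fin n) k) : Matrix (Fin n) (Fin n) k)) = 1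

lemma TrivialOnCentralizer.one_sub {ψ : AddChar k R} {Q : Matrix (Fin n) (Fin n) k}
    (h : TrivialOnCentralizer ψ Q) : TrivialOnCentralizer ψ (1 - Q) := by
  intro u t hu huQ htQ
  have := (Commute.one_right (u : Matrix (Fin n) (Fin n) k)).sub_right huQ
  have := (Commute.one_right (t : Matrix (Fin n) (Fin n) k)).sub_right htQ
  simp only [sub_sub_cancel] at *
  exact h u t hu ‹_› ‹_›

/-- If an idempotent `Q` has its rows from `m` on upper triangular, with `Q m m = 1`, then
the row above `m` vanishes up to the diagonal. -/
lemma idempotent_row_eq_zero (h2 : (2 : k) ≠ 0) {ψ : AddChar k R} (hψ : ψ ≠ 1)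
    {Q : Matrix (Fin n) (Fin n) k} (hQ : Q * Q = Q) (hT : TrivialOnCentralizer ψ Q)
    {i m : Fin n} (him : (i : ℕ) + 1 = m)
    (hrow : ∀ l j : Fin n, m ≤ l → j < l → Q l j = 0) (hmm : Q m m = 1)
    {j : Fin n} (hji : j ≤ i) : Q i j = 0 := by
  by_contra hne
  have hjm : j < m := Fin.lt_def.2 (by have := Fin.le_def.1 hji; omega)
  have hmj : Q m j = 0 := hrow m j le_rfl hjm
  set A := Q * single j m 1 * Q with hA
  set T := Q * single j i 1 * Q with hT'
  have hAA : A * A = 0 := by rw [hA, idempotent_single_mul hQ, hmj, zero_smul]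
  have hAT : A * T = 0 := by rw [hA, hT', idempotent_single_mul hQ, hmj, zero_smul]
  have hTA : T * A = Q i j • A := by rw [hA, hT', idempotent_single_mul hQ]
  have hTT : T * T = Q i j • T := by rw [hT', idempotent_single_mul hQ]
  have hQc (a b : Fin n) : Commute (Q * single a b 1 * Q) Q := by
    change Q * single a b 1 * Q * Q = Q * (Q * single a b 1 * Q)
    simp only [Matrix.mul_assoc, hQ]
    simp only [← Matrix.mul_assoc, hQ]
  let u (x : k) : GL (Fin n) k := ⟨1 + x • A, 1 - x • A,
    by simp [mul_sub, add_mul, hAA], by simp [mul_add, sub_mul, hAA]⟩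
  let t : GL (Fin n) k := ⟨1 - (2 * (Q i j)⁻¹) • T, 1 - (2 * (Q i j)⁻¹) • T, by
      simp only [mul_sub, sub_mul, mul_one, one_mul, smul_mul_smul_comm, hTT, smul_smul]
      rw [show 2 * (Q i j)⁻¹ * (2 * (Q i j)⁻¹) * Q i j = 2 * (2 * (Q i j)⁻¹) by field_simp]
      module, by
      simp only [mul_sub, sub_mul, mul_one, one_mul, smul_mul_smul_comm, hTT, smul_smul]
      rw [show 2 * (Q i j)⁻¹ * (2 * (Q i j)⁻¹) * Q i j = 2 * (2 * (Q i j)⁻¹) by field_simp]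
      module⟩
  have hAapp (a b : Fin n) : A a b = Q a j * Q m b := mul_single_mul_apply Q j m a b
  have hAzero (a b : Fin n) (hab : m ≤ a ∨ b < m) : A a b = 0 := by
    rw [hAapp]
    rcases hab with hab | hab
    · rw [hrow a j hab (hjm.trans_le hab), zero_mul]
    · rw [hrow m b le_rfl hab, mul_zero]
  have hu (x : k) : u x ∈ unitriangular k n := by
    intro a b hba
    change (1 + x • A) a b = _
    rw [Matrix.add_apply, Matrix.smul_apply, hAzero a b, smul_zero, add_zero, Matrix.one_apply]
    rcases le_or_gt m a with h | h
    · exact Or.inl h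
    · exact Or.inr (hba.trans_lt h)
  have huQ (x : k) : Commute (u x : Matrix (Fin n) (Fin n) k) Q :=
    (Commute.one_left Q).add_left ((hQc j m).smul_left x)
  have htQ : Commute (t : Matrix (Fin n) (Fin n) k) Q :=
    (Commute.one_left Q).sub_left ((hQc j i).smul_left _)
  have htu (x : k) : t * u x = (u x)⁻¹ * t := by
    apply Units.ext
    change (1 - (2 * (Q i j)⁻¹) • T) * (1 + x • A) = (1 - x • A) * (1 - (2 * (Q i j)⁻¹) • T)
    simp only [mul_sub, mul_add, sub_mul, mul_one, one_mul, smul_mul_smul_comm, hTA, hAT,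
      smul_smul, smul_zero]
    rw [show 2 * (Q i j)⁻¹ * x * Q i j = 2 * x by field_simp]
    module
  have hdiag (x : k) :
      superDiagSum k ((u x * u x : GL (Fin n) k) : Matrix (Fin n) (Fin n) k)
        = 2 * x * Q i j := by
    have huu : ((u x * u x : GL (Fin n) k) : Matrix (Fin n) (Fin n) k) = 1 + (2 * x) • A := by
      change (1 + x • A) * (1 + x • A) = _
      simp only [mul_add, add_mul, mul_one, one_mul, smul_mul_smul_comm, hAA, smul_zero,
        two_mul, add_smul]
      abel
    have hin : (i : ℕ) < n - 1 := by have := m.isLt; omega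
    rw [huu, superDiagSum, Finset.sum_eq_single ⟨i, hin⟩]
    · have hm' : (⟨(i : ℕ) + 1, by omega⟩ : Fin n) = m := Fin.ext him
      rw [Matrix.add_apply, Matrix.smul_apply, hAapp, Matrix.one_apply_ne]
      · simp only [hm', hmm, Fin.eta, mul_one, zero_add, smul_eq_mul]
      · simp [Fin.ext_iff]
    · intro l _ hl
      rw [Matrix.add_apply, Matrix.smul_apply, hAzero, Matrix.one_apply_ne, smul_zero, add_zero]
      · simp [Fin.ext_iff]
      · simp only [Fin.le_def, Fin.lt_def]
        have : (l : ℕ) ≠ i := fun h => hl (Fin.ext h)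
        omega
    · simp
  apply hψ
  ext y
  have := hT (u (y / (2 * Q i j))) t (hu _) (huQ _) htQ (htu _)
  rw [hdiag] at this
  rw [AddChar.one_apply, ← this]
  congr 1
  field_simp

/-- The rows of `Q` are upper triangular with diagonal entries alternating between `1` and
`0`, starting from the bottom. -/
lemma idempotent_alternating (h2 : (2 : k) ≠ 0) {ψ : AddChar k R} (hψ : ψ ≠ 1)
    {Q : Matrix (Fin n) (Fin n) k} (hQ : Q * Q = Q) (hT : TrivialOnCentralizer ψ Q)
    (hlast : ∀ i j : Fin n, (i : ℕ) = n - 1 → Q i j = if i = j then 1 else 0)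
    (i : Fin n) :
    (∀ j < i, Q i j = 0) ∧ Q i i = if Even (n - 1 - (i : ℕ)) then 1 else 0 := by
  obtain ⟨d, hd⟩ : ∃ d, d = n - 1 - (i : ℕ) := ⟨_, rfl⟩
  induction d using Nat.strong_induction_on generalizing i with
  | _ d ih =>
  rcases Nat.eq_zero_or_pos d with h0 | hpos
  · have hi : (i : ℕ) = n - 1 := by have := i.isLt; omega
    refine ⟨fun j hj => ?_, ?_⟩
    · rw [hlast i j hi, if_neg hj.ne']
    · rw [hlast i i hi, ← hd, h0]; simp
  · obtain ⟨m, him⟩ : ∃ m : Fin n, (i : ℕ) + 1 = m := ⟨⟨i + 1, by omega⟩, rfl⟩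
    have hd' : d = n - 1 - (m : ℕ) + 1 := by omega
    have hrow : ∀ l j : Fin n, m ≤ l → j < l → Q l j = 0 := fun l j hml hjl => by
      have := Fin.le_def.1 hml
      exact (ih (n - 1 - l) (by omega) l rfl).1 j hjl
    have hmm := (ih (n - 1 - m) (by omega) m rfl).2
    simp only [← hd, hd', Nat.even_add_one]
    by_cases he : Even (n - 1 - (m : ℕ))
    · rw [if_pos he] at hmm
      have key {j : Fin n} (hj : j ≤ i) : Q i j = 0 :=
        idempotent_row_eq_zero h2 hψ hQ hT him hrow hmm hj
      exact ⟨fun j hj => key hj.le, by rw [key le_rfl, if_neg (not_not.2 he)]⟩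
    · rw [if_neg he] at hmm
      have key {j : Fin n} (hj : j ≤ i) : (1 - Q) i j = 0 := by
        refine idempotent_row_eq_zero h2 hψ ?_ hT.one_sub him (fun l j hml hjl => ?_) ?_ hj
        · simp [mul_sub, sub_mul, hQ]
        · rw [Matrix.sub_apply, hrow l j hml hjl, Matrix.one_apply_ne hjl.ne', sub_zero]
        · simp [hmm]
      refine ⟨fun j hj => ?_, ?_⟩
      · simpa [Matrix.one_apply_ne hj.ne'] using key hj.le
      · rw [if_pos he]
        have := key le_rfl
        rw [Matrix.sub_apply, Matrix.one_apply_eq] at this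
        exact (sub_eq_zero.1 this).symm

lemma card_eq_of_conj_diagonal {Q : Matrix (Fin n) (Fin n) k} (p q : Fin n → Prop)
    [DecidablePred p] [DecidablePred q] (M : GL (Fin n) k)
    (hQ : Q = (M : Matrix (Fin n) (Fin n) k) * diagonal (fun i => if p i then (1 : k) else 0)
      * ((M⁻¹ : GL (Fin n) k) : Matrix (Fin n) (Fin n) k))
    (htri : ∀ i j : Fin n, j < i → Q i j = 0) (hdiag : ∀ i, Q i i = if q i then 1 else 0) :
    Finset.card {i | p i} = Finset.card {i | q i} := by
  classical
  have h1 : Q.charpoly = ∏ i, (Polynomial.X - Polynomial.C (if p i then (1 : k) else 0)) := by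
    rw [hQ, Matrix.coe_units_inv, Matrix.charpoly_units_conj, Matrix.charpoly_diagonal]
  have h2 : Q.charpoly = ∏ i, (Polynomial.X - Polynomial.C (if q i then (1 : k) else 0)) := by
    rw [Matrix.charpoly_of_isUpperTriangular Q fun i j hij => htri i j hij]
    simp only [hdiag]
  have hcount (f : Fin n → Prop) [DecidablePred f] :
      (∏ i, (Polynomial.X - Polynomial.C (if f i then (1 : k) else 0))).roots.count 1
        = Finset.card {i | f i} := by
    have : (∏ i, (Polynomial.X - Polynomial.C (if f i then (1 : k) else 0)))
        = (((Finset.univ : Finset (Fin n)).val.map fun i => if f i then (1 : k) else 0).map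
            fun a => Polynomial.X - Polynomial.C a).prod := by
      rw [Multiset.map_map]; rfl
    rw [this, Polynomial.roots_multiset_prod_X_sub_C, Multiset.count_map, ← Finset.filter_val,
      Finset.card_val]
    congr 1
    ext i
    by_cases h : f i <;> simp [h]
  rw [← hcount p, ← hcount q, ← h1, ← h2]

end Idempotent

lemma card_even_sub (n : ℕ) :
    Finset.card {i : Fin n | Even (n - 1 - (i : ℕ))} = (n + 1) / 2 := by
  induction n with
  | zero => simp
  | succ n ih =>
    rw [Fin.card_filter_univ_succ]
    have : Finset.card {i : Fin n | Even (n + 1 - 1 - ((Fin.succ i : Fin (n + 1)) : ℕ))}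
        = Finset.card {i : Fin n | Even (n - 1 - (i : ℕ))} := by
      congr 1
      ext i
      simp only [Fin.val_succ, Finset.mem_filter, Finset.mem_univ, true_and]
      rw [show n + 1 - 1 - ((i : ℕ) + 1) = n - 1 - i by omega]
    simp only [this, ih]
    by_cases h : Even n
    · simp only [Fin.val_zero, add_tsub_cancel_right, tsub_zero, h, if_true]
      obtain ⟨a, rfl⟩ := h
      omega
    · simp only [Fin.val_zero, add_tsub_cancel_right, tsub_zero, h, if_false]
      obtain ⟨a, rfl⟩ := Nat.not_even_iff_odd.1 h
      omega

lemma mem_levi_of_commute {k : Type} [Field k] {n : ℕ} {B : Fin n → Fin 2} {b : Fin 2}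
    {g : GL (Fin n) k}
    (h : Commute (g : Matrix (Fin n) (Fin n) k)
      (diagonal fun i => if B i = b then (1 : k) else 0)) :
    g ∈ levi k n 2 B := by
  intro i j hij
  have := congrFun (congrFun h.eq i) j
  rw [Matrix.mul_diagonal, Matrix.diagonal_mul] at this
  by_cases hi : B i = b
  · have hj : B j ≠ b := fun hj => hij (hi.trans hj.symm)
    simpa [hi, hj] using this.symm
  · have hj : B j = b := by omega
    simpa [hi, hj] using this

/-- If the mirabolic representation `Γ` of the mirabolic subgroup `P` of
`GL n k` admits a nonzero `(χ|_{P ∩ H_{r,s}})`-equivariant linear form, where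
`H_{r,s} = w_{r,s} (GL r × GL s) w_{r,s}⁻¹`, then `r = s`. -/
theorem mirabolic_distinction_forces_equal_blocks
    (p : ℕ) [Fact p.Prime] (hp2 : p ≠ 2)
    (k : Type) [Field k] [Fintype k] [CharP k p]
    (R : Type) [Field R] [IsAlgClosed R] (hchar : ringChar R ≠ p)
    (n r s : ℕ) (hn : 2 ≤ n) (hrs : s ≤ r) (hsum : r + s = n)
    (ψ : AddChar k R) (hψ : ψ ≠ 1)
    (w : GL (Fin n) k)
    (hw : ∀ i j : Fin n, (w : Matrix (Fin n) (Fin n) k) i j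
      = if (j : ℕ) = wfun n r s (i : ℕ) then 1 else 0)
    (χ : ↥(Subgroup.map (MulAut.conj w).toMonoidHom (levi k n 2 (twoBlocks n r))) →* R)
    (Λ : ↥(gammaCarrier n (by omega) ψ) →ₗ[R] R) (hΛ : Λ ≠ 0)
    (hrel : ∀ (x : GL (Fin n) k) (hxP : x ∈ mirabolic k n (by omega))
        (hxH : x ∈ Subgroup.map (MulAut.conj w).toMonoidHom (levi k n 2 (twoBlocks n r)))
        (f : ↥(gammaCarrier n (by omega) ψ)),
      Λ (gammaRep n (by omega) ψ ⟨x, hxP⟩ f) = χ ⟨x, hxH⟩ * Λ f) :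
    r = s := by
  have hn0 : 0 < n := by omega
  have h2 : (2 : k) ≠ 0 := by
    intro h
    have : p ∣ 2 := (CharP.cast_eq_zero_iff k p 2).1 (by exact_mod_cast h)
    exact hp2 ((Nat.prime_dvd_prime_iff_eq Fact.out Nat.prime_two).1 this)
  obtain ⟨g, F, hF, hsupp⟩ := exists_coset_supported hn0 ψ Λ hΛ
  have hwP : w ∈ mirabolic k n hn0 := by
    intro j
    rw [hw]
    have : wfun n r s (n - 1) = n - 1 := by
      simp only [wfun]
      split_ifs <;> omega
    simp only [this]
  set last : Fin n := ⟨n - 1, by omega⟩ with hlast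
  set D : Matrix (Fin n) (Fin n) k :=
    diagonal fun i => if twoBlocks n r i = twoBlocks n r last then (1 : k) else 0 with hD
  have hDD : D * D = D := by
    rw [hD, Matrix.diagonal_mul_diagonal]
    congr 1
    funext i
    split_ifs <;> simp
  set M : GL (Fin n) k := g.1 * w with hM
  have hMP : M ∈ mirabolic k n hn0 := mul_mem g.2 hwP
  set Q : Matrix (Fin n) (Fin n) k := (M : Matrix (Fin n) (Fin n) k) * D
    * ((M⁻¹ : GL (Fin n) k) : Matrix (Fin n) (Fin n) k) with hQdef
  have hMM : ((M⁻¹ : GL (Fin n) k) : Matrix (Fin n) (Fin n) k) * (M : Matrix (Fin n) (Fin n) k)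
      = 1 := by rw [← Units.val_mul, inv_mul_cancel, Units.val_one]
  have hMQ : ((M⁻¹ : GL (Fin n) k) : Matrix (Fin n) (Fin n) k) * Q
      = D * ((M⁻¹ : GL (Fin n) k) : Matrix (Fin n) (Fin n) k) := by
    rw [hQdef, ← Matrix.mul_assoc, ← Matrix.mul_assoc, hMM, Matrix.one_mul]
  have hQM : Q * (M : Matrix (Fin n) (Fin n) k) = (M : Matrix (Fin n) (Fin n) k) * D := by
    rw [hQdef, Matrix.mul_assoc, hMM, Matrix.mul_one]
  have hQQ : Q * Q = Q := by
    conv_lhs => rw [hQdef, Matrix.mul_assoc, hMQ, ← Matrix.mul_assoc, Matrix.mul_assoc _ D D, hDD]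
  have hQlast : ∀ i j : Fin n, (i : ℕ) = n - 1 → Q i j = if i = j then 1 else 0 := by
    intro i j hi
    obtain rfl : i = last := Fin.ext hi
    have hrow (A B : Matrix (Fin n) (Fin n) k)
        (hA : ∀ j, A last j = if (j : ℕ) = n - 1 then 1 else 0) (j : Fin n) :
        (A * B) last j = B last j := by
      rw [Matrix.mul_apply, Finset.sum_eq_single last]
      · rw [hA, if_pos rfl, one_mul]
      · intro l _ hl
        rw [hA, if_neg fun h => hl (Fin.ext h), zero_mul]
      · simp
    rw [hQdef, Matrix.mul_assoc, hrow _ _ hMP, hrow]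
    · rw [inv_mem hMP j]
      simp only [hlast, Fin.ext_iff, eq_comm]
    · intro j
      rw [hD, Matrix.diagonal_apply]
      by_cases h : last = j
      · subst h; simp [hlast]
      · rw [if_neg h, if_neg fun h' => h (Fin.ext h'.symm)]
  have hH (y : GL (Fin n) k) (hy : Commute (y : Matrix (Fin n) (Fin n) k) Q) :
      g.1⁻¹ * y * g.1 ∈
        Subgroup.map (MulAut.conj w).toMonoidHom (levi k n 2 (twoBlocks n r)) := by
    refine ⟨M⁻¹ * y * M, mem_levi_of_commute (b := twoBlocks n r last) ?_, ?_⟩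
    · change ((M⁻¹ : GL (Fin n) k) : Matrix (Fin n) (Fin n) k) * (y : Matrix (Fin n) (Fin n) k)
        * (M : Matrix (Fin n) (Fin n) k) * D = D * (((M⁻¹ : GL (Fin n) k) :
          Matrix (Fin n) (Fin n) k) * (y : Matrix (Fin n) (Fin n) k)
            * (M : Matrix (Fin n) (Fin n) k))
      rw [Matrix.mul_assoc _ _ D, ← hQM, ← Matrix.mul_assoc, Matrix.mul_assoc _ _ Q, hy.eq,
        ← Matrix.mul_assoc, hMQ]
      simp only [Matrix.mul_assoc]
    · change w * (M⁻¹ * y * M) * w⁻¹ = _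
      rw [hM]
      group
  have hT : TrivialOnCentralizer ψ Q := by
    intro u t hu huQ htQ htu
    have huu := mul_mem hu hu
    have huuQ : Commute ((u * u : GL (Fin n) k) : Matrix (Fin n) (Fin n) k) Q :=
      huQ.mul_left huQ
    let a : ↥(Subgroup.map (MulAut.conj w).toMonoidHom (levi k n 2 (twoBlocks n r))) :=
      ⟨_, hH u huQ⟩
    let b : ↥(Subgroup.map (MulAut.conj w).toMonoidHom (levi k n 2 (twoBlocks n r))) :=
      ⟨_, hH t htQ⟩
    have hab : b * a = a⁻¹ * b := by
      refine Subtype.ext ?_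
      change g.1⁻¹ * t * g.1 * (g.1⁻¹ * u * g.1) = (g.1⁻¹ * u * g.1)⁻¹ * (g.1⁻¹ * t * g.1)
      have : g.1⁻¹ * t * g.1 * (g.1⁻¹ * u * g.1) = g.1⁻¹ * (t * u) * g.1 := by group
      rw [this, htu]
      group
    have hχ : χ (a * a) = 1 := by
      have hconj : a * a = a * (b⁻¹ * a⁻¹ * b) := by
        rw [mul_assoc b⁻¹, ← hab]; group
      rw [hconj, map_mul, map_mul, map_mul, mul_right_comm (χ b⁻¹), ← map_mul χ b⁻¹,
        inv_mul_cancel, map_one, one_mul, ← map_mul, mul_inv_cancel, map_one]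
    have hmem : (g⁻¹ * ⟨u * u, unitriangular_le_mirabolic hn0 huu⟩ * g :
        ↥(mirabolic k n hn0)).1 = (a * a).1 := by
      change g.1⁻¹ * (u * u) * g.1 = g.1⁻¹ * u * g.1 * (g.1⁻¹ * u * g.1)
      group
    have hrep := gammaRep_of_coset_supported hn0 ψ g F hsupp
      ⟨u * u, unitriangular_le_mirabolic hn0 huu⟩
      (g⁻¹ * ⟨u * u, unitriangular_le_mirabolic hn0 huu⟩ * g) huu (by group)
    have hΛF := hrel _ (g⁻¹ * ⟨u * u, unitriangular_le_mirabolic hn0 huu⟩ * g :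
        ↥(mirabolic k n hn0)).2 (hmem ▸ (a * a).2) F
    have hχ' : χ ⟨_, hmem ▸ (a * a).2⟩ = 1 := (congrArg χ (Subtype.ext hmem)).trans hχ
    rw [hχ', one_mul] at hΛF
    have hΛF' := (congrArg Λ hrep).symm.trans hΛF
    rw [map_smul, smul_eq_mul] at hΛF'
    exact mul_right_cancel₀ hF (hΛF'.trans (one_mul _).symm)
  have halt := idempotent_alternating h2 hψ hQQ hT hQlast
  have hcard := card_eq_of_conj_diagonal (fun i => twoBlocks n r i = twoBlocks n r last)
    (fun i : Fin n => Even (n - 1 - (i : ℕ))) M hQdef (fun i j hij => (halt i).1 j hij)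
    fun i => (halt i).2
  rw [card_even_sub] at hcard
  have hlt := Fin.card_filter_val_lt (n := n) (m := r)
  have hadd := Finset.card_filter_add_card_filter_not (s := (Finset.univ : Finset (Fin n)))
    (fun i : Fin n => (i : ℕ) < r)
  rw [Finset.card_univ, Fintype.card_fin] at hadd
  by_cases hs : s = 0
  · have : ∀ i : Fin n, twoBlocks n r i = twoBlocks n r last := by
      intro i
      have := i.isLt
      simp only [twoBlocks, hlast]
      rw [if_pos (by omega), if_pos (by omega)]
    simp only [this, Finset.filter_true, Finset.card_univ, Fintype.card_fin] at hcard
    omega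
  · have : ∀ i : Fin n, twoBlocks n r i = twoBlocks n r last ↔ ¬ (i : ℕ) < r := by
      intro i
      simp only [twoBlocks, hlast]
      rw [if_neg (show ¬ n - 1 < r by omega)]
      split_ifs <;> simp_all
    simp only [this] at hcard
    omega
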